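/- arXiv:math/0405232 — 2 statements merged into one kernel-verified Lean document; each statement's English description precedes it below -/
import Mathlib

section
/- Let q ≥ 1 be an integer with q ≡ 1 (mod N) and let x₁, …, x_q ∈ ℂ be pairwise incongruent modulo the lattice L(τ) (i.e. x_i − x_j ∉ L(τ) for i ≠ j) with x_i ∉ L(τ) for every i. Then ∑_{i=1}^{q} (1/f(x_i)) · ( ∏_{j ≠ i} 1/f(x_j − x_i) − ∏_{j ≠ i} x_j/(f(x_j)·(x_j − x_i)) ) = 0. -/
open Complex

/-- `Φ(τ,x) = (1 − e^{−x}) ∏_{n≥1} (1 − qⁿe^{−x})(1 − qⁿeˣ)/(1 − qⁿ)²` with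
`q = exp(2πiτ)`. -/
noncomputable def Phi (τ x : ℂ) : ℂ :=
  (1 - Complex.exp (-x)) *
    ∏' n : ℕ,
      ((1 - Complex.exp (2 * Real.pi * Complex.I * τ) ^ (n + 1) * Complex.exp (-x)) *
        (1 - Complex.exp (2 * Real.pi * Complex.I * τ) ^ (n + 1) * Complex.exp x) /
        (1 - Complex.exp (2 * Real.pi * Complex.I * τ) ^ (n + 1)) ^ 2)

/-- The lattice `L(τ) = {2πi(mτ + n) : m, n ∈ ℤ}`. -/
def lat (τ : ℂ) : Set ℂ :=
  {z | ∃ m n : ℤ, z = 2 * Real.pi * Complex.I * (m * τ + n)}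

/-- The normalized elliptic function `f` of level `N`:
`f(x) = Φ(τ,x)·Φ(τ,−α)/Φ(τ,x−α)` with `α = 2πi/N` (division by `0` yields `0`). -/
noncomputable def ellf (τ : ℂ) (N : ℕ) (x : ℂ) : ℂ :=
  Phi τ x * Phi τ (-(2 * Real.pi * Complex.I / N)) /
    Phi τ (x - 2 * Real.pi * Complex.I / N)

/-- The extended reciprocal `1/f(x) = Φ(τ,x−α)/(Φ(τ,x)·Φ(τ,−α))`, with the
convention that a quotient with vanishing denominator is `0`. -/
noncomputable def invEllf (τ : ℂ) (N : ℕ) (x : ℂ) : ℂ :=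
  Phi τ (x - 2 * Real.pi * Complex.I / N) /
    (Phi τ x * Phi τ (-(2 * Real.pi * Complex.I / N)))

open Filter Topology

/-- The product `∏_{n ≥ 1} (1 - qⁿ u)`. -/
noncomputable def eulerProd (q u : ℂ) : ℂ := ∏' n : ℕ, (1 - q ^ (n + 1) * u)

lemma summable_norm_pow_succ_mul {q : ℂ} (hq : ‖q‖ < 1) (u : ℂ) :
    Summable fun n : ℕ ↦ ‖-(q ^ (n + 1) * u)‖ := by
  simpa [pow_succ] using
    ((summable_geometric_of_lt_one (norm_nonneg q) hq).mul_right ‖q‖).mul_right ‖u‖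

lemma multipliable_eulerProd {q : ℂ} (hq : ‖q‖ < 1) (u : ℂ) :
    Multipliable fun n : ℕ ↦ 1 - q ^ (n + 1) * u := by
  simpa only [sub_eq_add_neg] using
    multipliable_one_add_of_summable (summable_norm_pow_succ_mul hq u)

lemma eulerProd_ne_zero {q : ℂ} (hq : ‖q‖ < 1) {u : ℂ} (hu : ∀ n : ℕ, q ^ (n + 1) * u ≠ 1) :
    eulerProd q u ≠ 0 := by
  simpa only [eulerProd, sub_eq_add_neg] using
    tprod_one_add_ne_zero_of_summable
      (fun n ↦ by rw [← sub_eq_add_neg, sub_ne_zero]; exact (hu n).symm)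
      (summable_norm_pow_succ_mul hq u)

lemma eulerProd_one_ne_zero {q : ℂ} (hq : ‖q‖ < 1) : eulerProd q 1 ≠ 0 := by
  refine eulerProd_ne_zero hq fun n h ↦ ?_
  have h1 : ‖q‖ ^ (n + 1) < 1 := pow_lt_one₀ (norm_nonneg q) hq n.succ_ne_zero
  rw [← norm_pow, ← mul_one (q ^ (n + 1)), h, norm_one] at h1
  exact lt_irrefl _ h1

lemma eulerProd_eq_mul {q : ℂ} (hq : ‖q‖ < 1) (u : ℂ) :
    eulerProd q u = (1 - q * u) * eulerProd q (q * u) := by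
  have hshift : ∀ n : ℕ, 1 - q ^ (n + 1 + 1) * u = 1 - q ^ (n + 1) * (q * u) :=
    fun n ↦ by ring
  have hm : Multipliable fun n : ℕ ↦ 1 - q ^ (n + 1 + 1) * u :=
    (multipliable_eulerProd hq (q * u)).congr fun n ↦ (hshift n).symm
  calc eulerProd q u = (1 - q ^ (0 + 1) * u) * ∏' n : ℕ, (1 - q ^ (n + 1 + 1) * u) :=
        tprod_eq_zero_mul' hm
    _ = (1 - q * u) * eulerProd q (q * u) := by
        rw [tprod_congr hshift, zero_add, pow_one, eulerProd]

lemma differentiable_eulerProd {q : ℂ} (hq : ‖q‖ < 1) : Differentiable ℂ (eulerProd q) := by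
  intro u
  have hloc : HasProdLocallyUniformlyOn (fun (n : ℕ) (v : ℂ) ↦ 1 + -(q ^ (n + 1) * v))
      (fun v ↦ ∏' n : ℕ, (1 + -(q ^ (n + 1) * v))) (Metric.ball 0 (‖u‖ + 1)) := by
    refine Summable.hasProdLocallyUniformlyOn_nat_one_add Metric.isOpen_ball
      (summable_norm_pow_succ_mul hq ((‖u‖ + 1 : ℝ) : ℂ)) (.of_forall fun n v hv ↦ ?_)
      fun n ↦ by fun_prop
    rw [mem_ball_zero_iff] at hv
    rw [norm_neg, norm_neg, norm_mul, norm_mul, norm_real, Real.norm_of_nonneg (by positivity)]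
    gcongr
  have hd := hloc.differentiableOn
    (.of_forall fun _ ↦ by
      simpa [Finset.prod_fn] using DifferentiableOn.finsetProd (fun _ _ ↦ by fun_prop))
    Metric.isOpen_ball
  have := hd.differentiableAt (Metric.isOpen_ball.mem_nhds
    (show u ∈ Metric.ball (0 : ℂ) (‖u‖ + 1) by simp))
  simpa only [← sub_eq_add_neg] using! this

lemma norm_exp_two_pi_I_mul_lt_one {τ : ℂ} (hτ : 0 < τ.im) :
    ‖exp (2 * Real.pi * I * τ)‖ < 1 := UpperHalfPlane.norm_exp_two_pi_I_lt_one ⟨τ, hτ⟩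

section Phi

variable {τ : ℂ}

lemma Phi_eq (hτ : 0 < τ.im) (x : ℂ) :
    Phi τ x = (1 - exp (-x)) * (eulerProd (exp (2 * Real.pi * I * τ)) (exp (-x)) *
      eulerProd (exp (2 * Real.pi * I * τ)) (exp x) /
      eulerProd (exp (2 * Real.pi * I * τ)) 1 ^ 2) := by
  have hq := norm_exp_two_pi_I_mul_lt_one hτ
  have h1 := eulerProd_one_ne_zero hq
  set q := exp (2 * Real.pi * I * τ) with hqd
  have h := ((multipliable_eulerProd hq (exp (-x))).hasProd.mul
    (multipliable_eulerProd hq (exp x)).hasProd).div₀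
    ((multipliable_eulerProd hq 1).hasProd.mul (multipliable_eulerProd hq 1).hasProd)
    (mul_ne_zero h1 h1)
  rw [Phi, ← hqd]
  congr 1
  rw [sq]
  refine Eq.trans (tprod_congr fun n ↦ ?_) h.tprod_eq
  simp [sq]

lemma differentiable_Phi (hτ : 0 < τ.im) : Differentiable ℂ (Phi τ) := by
  have hE := differentiable_eulerProd (norm_exp_two_pi_I_mul_lt_one hτ)
  rw [funext (Phi_eq hτ)]
  have h1 : Differentiable ℂ fun x : ℂ ↦
      eulerProd (exp (2 * Real.pi * I * τ)) (exp (-x)) := hE.comp (by fun_prop)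
  have h2 : Differentiable ℂ fun x : ℂ ↦
      eulerProd (exp (2 * Real.pi * I * τ)) (exp x) := hE.comp (by fun_prop)
  fun_prop

lemma Phi_zero : Phi τ 0 = 0 := by simp [Phi]

lemma deriv_Phi_zero (hτ : 0 < τ.im) : deriv (Phi τ) 0 = 1 := by
  have hq := norm_exp_two_pi_I_mul_lt_one hτ
  have hE := differentiable_eulerProd hq
  have h0 := eulerProd_one_ne_zero hq
  have h1 : Differentiable ℂ fun x : ℂ ↦
      eulerProd (exp (2 * Real.pi * I * τ)) (exp (-x)) := hE.comp (by fun_prop)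
  have h2 : Differentiable ℂ fun x : ℂ ↦
      eulerProd (exp (2 * Real.pi * I * τ)) (exp x) := hE.comp (by fun_prop)
  have h3 : HasDerivAt (fun x : ℂ ↦ 1 - exp (-x)) 1 0 := by
    simpa using ((hasDerivAt_neg (0 : ℂ)).cexp).const_sub 1
  have h4 : DifferentiableAt ℂ (fun x : ℂ ↦
      eulerProd (exp (2 * Real.pi * I * τ)) (exp (-x)) *
      eulerProd (exp (2 * Real.pi * I * τ)) (exp x) /
      eulerProd (exp (2 * Real.pi * I * τ)) 1 ^ 2) 0 := by fun_prop
  rw [funext (Phi_eq hτ)]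
  refine (h3.mul h4.hasDerivAt).deriv.trans ?_
  simp only [neg_zero, exp_zero, sub_self, zero_mul, add_zero, one_mul]
  rw [← sq, div_self (pow_ne_zero 2 h0)]

lemma Phi_add_two_pi_I (x : ℂ) : Phi τ (x + 2 * Real.pi * I) = Phi τ x := by
  have h : exp (-(x + 2 * Real.pi * I)) = exp (-x) := by
    rw [neg_add, ← sub_eq_add_neg, exp_periodic.sub_eq]
  simp only [Phi, h, exp_periodic x]

lemma Phi_add_two_pi_I_mul (hτ : 0 < τ.im) (x : ℂ) :
    Phi τ (x + 2 * Real.pi * I * τ) = -exp (-(2 * Real.pi * I * τ) - x) * Phi τ x := by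
  have hq := norm_exp_two_pi_I_mul_lt_one hτ
  rw [Phi_eq hτ, Phi_eq hτ, neg_add, exp_add, exp_add, exp_sub, exp_neg (2 * Real.pi * I * τ)]
  have hq0 := exp_ne_zero (2 * Real.pi * I * τ)
  set q := exp (2 * Real.pi * I * τ)
  rw [eulerProd_eq_mul hq (exp (-x) * q⁻¹), eulerProd_eq_mul hq (exp x), exp_neg]
  have hu := exp_ne_zero x
  generalize exp x = u at *
  rw [show q * (u⁻¹ * q⁻¹) = u⁻¹ by field_simp, mul_comm u q]
  field_simp
  ring

lemma Phi_ne_zero (hτ : 0 < τ.im) {x : ℂ} (hx : x ∉ lat τ) : Phi τ x ≠ 0 := by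
  have hq := norm_exp_two_pi_I_mul_lt_one hτ
  have key : ∀ m : ℤ, ∀ y : ℂ, (y = x ∨ y = -x) →
      exp (m * (2 * Real.pi * I * τ) + y) ≠ 1 := by
    intro m y hy h
    obtain ⟨n, hn⟩ := exp_eq_one_iff.1 h
    refine hx ?_
    rcases hy with rfl | rfl
    · exact ⟨-m, n, by push_cast; linear_combination hn⟩
    · exact ⟨m, -n, by push_cast; linear_combination -hn⟩
  have key' : ∀ (y : ℂ), (y = x ∨ y = -x) →
      eulerProd (exp (2 * Real.pi * I * τ)) (exp y) ≠ 0 := by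
    refine fun y hy ↦ eulerProd_ne_zero hq fun n h ↦ key (n + 1) y hy ?_
    rw [← h, ← exp_nat_mul, ← exp_add]
    push_cast
    rfl
  rw [Phi_eq hτ]
  refine mul_ne_zero (sub_ne_zero.2 fun h ↦ key 0 (-x) (.inr rfl) (by simpa using h.symm)) ?_
  exact div_ne_zero (mul_ne_zero (key' _ (.inr rfl)) (key' _ (.inl rfl)))
    (pow_ne_zero 2 (eulerProd_one_ne_zero hq))

end Phi

section invEllf

variable {τ : ℂ} {N : ℕ}

lemma invEllf_def (x : ℂ) : invEllf τ N x = Phi τ (x - 2 * Real.pi * I / N) /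
    (Phi τ x * Phi τ (-(2 * Real.pi * I / N))) := rfl

lemma analyticAt_invEllf (hτ : 0 < τ.im) {x : ℂ} (hx : x ∉ lat τ) :
    AnalyticAt ℂ (invEllf τ N) x := by
  have hΦ : ∀ y, AnalyticAt ℂ (Phi τ) y := fun y ↦ (differentiable_Phi hτ).analyticAt y
  have h1 : AnalyticAt ℂ (fun y ↦ Phi τ (y - 2 * Real.pi * I / N)) x :=
    ((differentiable_Phi hτ).comp (by fun_prop : Differentiable ℂ fun y : ℂ ↦
      y - 2 * Real.pi * I / N)).analyticAt x
  have h2 : AnalyticAt ℂ (fun y ↦ Phi τ (y - 2 * Real.pi * I / N) / Phi τ y *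
      (Phi τ (-(2 * Real.pi * I / N)))⁻¹) x :=
    (h1.div (hΦ x) (Phi_ne_zero hτ hx)).mul analyticAt_const
  refine h2.congr (.of_forall fun y ↦ ?_)
  rw [invEllf, div_mul_eq_div_div, div_eq_mul_inv _ (Phi τ (-_))]

lemma invEllf_add_two_pi_I (x : ℂ) : invEllf τ N (x + 2 * Real.pi * I) = invEllf τ N x := by
  rw [invEllf, invEllf, add_sub_right_comm, Phi_add_two_pi_I, Phi_add_two_pi_I]

lemma invEllf_add_two_pi_I_mul (hτ : 0 < τ.im) (x : ℂ) :
    invEllf τ N (x + 2 * Real.pi * I * τ) = exp (2 * Real.pi * I / N) * invEllf τ N x := by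
  rw [invEllf, invEllf, add_sub_right_comm, Phi_add_two_pi_I_mul hτ, Phi_add_two_pi_I_mul hτ,
    show -(2 * Real.pi * I * τ) - (x - 2 * Real.pi * I / N) =
      2 * Real.pi * I / N + (-(2 * Real.pi * I * τ) - x) by ring, exp_add]
  have := exp_ne_zero (-(2 * Real.pi * I * τ) - x)
  generalize exp (-(2 * Real.pi * I * τ) - x) = u at *
  rw [neg_mul, mul_assoc, mul_assoc, neg_mul, neg_mul, neg_div_neg_eq, mul_left_comm, mul_assoc u,
    mul_div_mul_left _ _ this, mul_div_assoc]

lemma invEllf_add_lattice (hτ : 0 < τ.im) (m n : ℤ) (x : ℂ) :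
    invEllf τ N (x + 2 * Real.pi * I * (m * τ + n)) =
      exp (2 * Real.pi * I / N) ^ m * invEllf τ N x := by
  have h1 : Function.Periodic (invEllf τ N) (2 * Real.pi * I) := invEllf_add_two_pi_I
  have h2 : ∀ m : ℤ, ∀ y, invEllf τ N (y + m * (2 * Real.pi * I * τ)) =
      exp (2 * Real.pi * I / N) ^ m * invEllf τ N y := by
    intro m
    have h0 := exp_ne_zero (2 * Real.pi * I / N)
    induction m using Int.induction_on with
    | zero => simp
    | succ k ih =>
      intro y
      rw [zpow_add_one₀ h0, mul_assoc (_ ^ _), ← invEllf_add_two_pi_I_mul hτ, ← ih]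
      congr 1
      push_cast
      ring
    | pred k ih =>
      intro y
      refine mul_left_cancel₀ h0 ?_
      rw [← mul_assoc (exp _), ← zpow_one_add₀ h0, ← invEllf_add_two_pi_I_mul hτ,
        show 1 + (-(k : ℤ) - 1) = -k by ring, ← ih]
      congr 1
      push_cast
      ring
  rw [← h2 m x, ← h1.int_mul n (x + m * (2 * Real.pi * I * τ))]
  congr 1
  ring

end invEllf

lemma exists_sub_lattice_norm_le {τ : ℂ} (hτ : 0 < τ.im) :
    ∃ R : ℝ, ∀ z : ℂ, ∃ m n : ℤ, ‖z + 2 * Real.pi * I * (m * τ + n)‖ ≤ R := by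
  refine ⟨2 * Real.pi * (1 + τ.im), fun z ↦ ?_⟩
  set w := z / (2 * Real.pi * I) with hw
  set m := ⌊w.im / τ.im⌋ with hm
  set n := ⌊(w - m * τ).re⌋ with hn
  refine ⟨-m, -n, ?_⟩
  have h2 : (2 * Real.pi * I : ℂ) ≠ 0 := two_pi_I_ne_zero
  have hz : z + 2 * Real.pi * I * ((-m : ℤ) * τ + (-n : ℤ)) =
      2 * Real.pi * I * (w - m * τ - n) := by
    rw [hw]
    push_cast
    field_simp
    ring
  have hre : |(w - m * τ - n).re| ≤ 1 := by
    have : (w - m * τ - n).re = Int.fract (w - m * τ).re := by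
      rw [Int.fract, ← hn]
      simp
    rw [this, abs_of_nonneg (Int.fract_nonneg _)]
    exact (Int.fract_lt_one _).le
  have him : |(w - m * τ - n).im| ≤ τ.im := by
    have : (w - m * τ - n).im = Int.fract (w.im / τ.im) * τ.im := by
      rw [Int.fract, ← hm, sub_mul, div_mul_cancel₀ _ hτ.ne']
      simp
    rw [this, abs_of_nonneg (mul_nonneg (Int.fract_nonneg _) hτ.le)]
    exact mul_le_of_le_one_left hτ.le (Int.fract_lt_one _).le
  rw [hz, norm_mul]
  have hnorm : ‖(2 * Real.pi * I : ℂ)‖ = 2 * Real.pi := by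
    simp [abs_of_pos Real.pi_pos]
  rw [hnorm]
  gcongr
  exact (norm_le_abs_re_add_abs_im _).trans (add_le_add hre him)

/-- A function all of whose singularities are removable has an entire extension. -/
lemma exists_differentiable_tendsto_nhdsNE {D : ℂ → ℂ}
    (hD : ∀ p, ∃ g, AnalyticAt ℂ g p ∧ D =ᶠ[𝓝[≠] p] g) :
    ∃ G : ℂ → ℂ, Differentiable ℂ G ∧ ∀ p, Tendsto D (𝓝[≠] p) (𝓝 (G p)) := by
  have htend : ∀ {p g}, AnalyticAt ℂ g p → D =ᶠ[𝓝[≠] p] g → Tendsto D (𝓝[≠] p) (𝓝 (g p)) :=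
    fun hg hDg ↦ (tendsto_congr' hDg).2 (hg.continuousAt.tendsto.mono_left nhdsWithin_le_nhds)
  refine ⟨fun p ↦ limUnder (𝓝[≠] p) D, fun p ↦ ?_, fun p ↦ ?_⟩
  · obtain ⟨g, hg, hDg⟩ := hD p
    refine hg.differentiableAt.congr_of_eventuallyEq ?_
    filter_upwards [hg.eventually_analyticAt,
      eventually_eventually_nhds.2 (eventually_nhdsWithin_iff.1 hDg)] with w hw hw'
    refine (htend hw ?_).limUnder_eq
    by_cases hwp : w = p
    · exact hwp ▸ hDg
    · refine Eventually.filter_mono nhdsWithin_le_nhds ?_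
      filter_upwards [hw', isOpen_ne.mem_nhds hwp] with v hv hvp using hv hvp
  · obtain ⟨g, hg, hDg⟩ := hD p
    exact tendsto_nhds_limUnder ⟨_, htend hg hDg⟩

/-- A function with removable singularities and unitary multipliers with respect to a lattice,
one of them nontrivial, vanishes wherever it is continuous. -/
lemma eq_zero_of_lattice_multiplier {τ : ℂ} (hτ : 0 < τ.im) {ζ : ℂ} (hζ : ‖ζ‖ = 1) (hζ1 : ζ ≠ 1)
    {D : ℂ → ℂ} (hD : ∀ p, ∃ g, AnalyticAt ℂ g p ∧ D =ᶠ[𝓝[≠] p] g)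
    (hmul : ∀ (m n : ℤ) z, D (z + 2 * Real.pi * I * (m * τ + n)) = ζ ^ m * D z)
    {z : ℂ} (hz : ContinuousAt D z) : D z = 0 := by
  obtain ⟨G, hG, hlim⟩ := exists_differentiable_tendsto_nhdsNE hD
  have hGmul : ∀ (m n : ℤ) z, G (z + 2 * Real.pi * I * (m * τ + n)) = ζ ^ m * G z := by
    intro m n z
    refine tendsto_nhds_unique ?_ ((hlim z).const_mul (ζ ^ m))
    simp_rw [← hmul m n]
    refine (hlim _).comp (tendsto_nhdsWithin_iff.2 ⟨?_, ?_⟩)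
    · exact ((continuous_add_const _).tendsto z).mono_left nhdsWithin_le_nhds
    · filter_upwards [self_mem_nhdsWithin] with w hw
      simpa using hw
  have hbdd : Bornology.IsBounded (Set.range G) := by
    obtain ⟨R, hR⟩ := exists_sub_lattice_norm_le hτ
    obtain ⟨C, hC⟩ := (isCompact_closedBall (0 : ℂ) R).exists_bound_of_continuousOn
      hG.continuous.continuousOn
    refine isBounded_iff_forall_norm_le.2 ⟨C, ?_⟩
    rintro _ ⟨z, rfl⟩
    obtain ⟨m, n, hmn⟩ := hR z
    have := hC _ (mem_closedBall_zero_iff.2 hmn)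
    rwa [hGmul, norm_mul, norm_zpow, hζ, one_zpow, one_mul] at this
  have h1 : G z = ζ * G z := by
    have := hGmul 1 0 z
    rwa [hG.apply_eq_apply_of_bounded hbdd _ z, zpow_one] at this
  have h2 : G z = 0 := by
    have : (1 - ζ) * G z = 0 := by linear_combination h1
    exact (mul_eq_zero.1 this).resolve_left (sub_ne_zero.2 hζ1.symm)
  rw [← h2]
  exact tendsto_nhds_unique (hz.tendsto.mono_left nhdsWithin_le_nhds) (hlim z)

lemma zero_mem_lat {τ : ℂ} : (0 : ℂ) ∈ lat τ := ⟨0, 0, by simp⟩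

/-- At a simple zero `p` of `T`, the singularity of `A / T * (P - P p)` is removable. -/
lemma exists_analyticAt_eventuallyEq_div_mul_sub {A T P : ℂ → ℂ} {p : ℂ} (hA : AnalyticAt ℂ A p)
    (hT : AnalyticAt ℂ T p) (hP : AnalyticAt ℂ P p) (hT0 : T p = 0) (hT' : deriv T p ≠ 0) :
    ∃ g, AnalyticAt ℂ g p ∧ (fun z ↦ A z / T z * (P z - P p)) =ᶠ[𝓝[≠] p] g := by
  have hdsl : ∀ {F : ℂ → ℂ}, AnalyticAt ℂ F p → AnalyticAt ℂ (dslope F p) p := by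
    rintro F ⟨s, hs⟩
    exact ⟨_, hs.has_fpower_series_dslope_fslope⟩
  refine ⟨fun z ↦ A z * (dslope P p z / dslope T p z),
    hA.mul ((hdsl hP).div (hdsl hT) (by rwa [dslope_same])), ?_⟩
  filter_upwards [self_mem_nhdsWithin] with z hz
  have hz' : z - p ≠ 0 := sub_ne_zero.2 hz
  rw [dslope_of_ne _ hz, dslope_of_ne _ hz, slope_def_field, slope_def_field, hT0, sub_zero,
    div_div_div_cancel_right₀ hz', div_mul_eq_mul_div, mul_div_assoc]

/-- Partial fraction expansion of `z ↦ ∏ⱼ 1/f(xⱼ - z)`. -/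
lemma prod_invEllf_sub_eq_sum {τ : ℂ} (hτ : 0 < τ.im) {N : ℕ} (hN : 2 ≤ N)
    {q : ℕ} (hqN : q % N = 1) {x : Fin q → ℂ} (hxd : ∀ i j, i ≠ j → x i - x j ∉ lat τ)
    {z₀ : ℂ} (hz₀ : ∀ i, x i - z₀ ∉ lat τ) :
    ∏ j, invEllf τ N (x j - z₀) =
      ∑ i, (∏ j ∈ Finset.univ.erase i, invEllf τ N (x j - x i)) * invEllf τ N (x i - z₀) := by
  set ζ := exp (2 * Real.pi * I / N) with hζd
  have hprim : IsPrimitiveRoot ζ N := isPrimitiveRoot_exp N (by omega)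
  have hζ0 : ζ ≠ 0 := exp_ne_zero _
  set c : Fin q → ℂ := fun i ↦ ∏ j ∈ Finset.univ.erase i, invEllf τ N (x j - x i) with hc
  set D : ℂ → ℂ := fun z ↦ ∏ j, invEllf τ N (x j - z) - ∑ i, c i * invEllf τ N (x i - z) with hDd
  have hshift : ∀ (m n : ℤ) (i : Fin q) (z : ℂ),
      invEllf τ N (x i - (z + 2 * Real.pi * I * (m * τ + n))) =
        ζ⁻¹ ^ m * invEllf τ N (x i - z) := by
    intro m n i z
    rw [inv_zpow', ← invEllf_add_lattice hτ (-m) (-n)]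
    congr 1
    push_cast
    ring
  have hζq : ∀ m : ℤ, (ζ⁻¹ ^ m) ^ q = ζ⁻¹ ^ m := by
    intro m
    have hζq' : ζ⁻¹ ^ q = ζ⁻¹ := by
      rw [← Nat.div_add_mod q N, hqN, pow_add, pow_mul, inv_pow, hprim.pow_eq_one]
      simp
    rw [← zpow_natCast, ← zpow_mul, mul_comm, zpow_mul, zpow_natCast, hζq']
  have hmul : ∀ (m n : ℤ) z, D (z + 2 * Real.pi * I * (m * τ + n)) = ζ⁻¹ ^ m * D z := by
    intro m n z
    simp only [hDd, hshift, Finset.prod_mul_distrib, Finset.prod_const, Finset.card_univ,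
      Fintype.card_fin, hζq, mul_sub, Finset.mul_sum]
    congr 1
    exact Finset.sum_congr rfl fun i _ ↦ by ring
  have han : ∀ i z, x i - z ∉ lat τ → AnalyticAt ℂ (fun w ↦ invEllf τ N (x i - w)) z :=
    fun i z hz ↦ (analyticAt_invEllf hτ hz).fun_comp (f := fun w ↦ x i - w) (by fun_prop)
  have hD_an : ∀ z, (∀ i, x i - z ∉ lat τ) → AnalyticAt ℂ D z := fun z hz ↦
    (Finset.analyticAt_fun_prod _ fun i _ ↦ han i z (hz i)).sub
      (Finset.analyticAt_fun_sum _ fun i _ ↦ analyticAt_const.mul (han i z (hz i)))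
  have hD_pole : ∀ i, ∃ g, AnalyticAt ℂ g (x i) ∧ D =ᶠ[𝓝[≠] x i] g := by
    intro i
    have hΦ := differentiable_Phi hτ
    have hP : AnalyticAt ℂ (fun z ↦ ∏ j ∈ Finset.univ.erase i, invEllf τ N (x j - z)) (x i) :=
      Finset.analyticAt_fun_prod _ fun j hj ↦ han j _ (hxd j i (Finset.ne_of_mem_erase hj))
    have hS : AnalyticAt ℂ (fun z ↦ ∑ j ∈ Finset.univ.erase i, c j * invEllf τ N (x j - z))
        (x i) :=
      Finset.analyticAt_fun_sum _ fun j hj ↦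
        analyticAt_const.mul (han j _ (hxd j i (Finset.ne_of_mem_erase hj)))
    have hT : Differentiable ℂ fun z ↦ Phi τ (x i - z) := hΦ.comp (by fun_prop)
    have hA : Differentiable ℂ fun z ↦ Phi τ (x i - z - 2 * Real.pi * I / N) /
        Phi τ (-(2 * Real.pi * I / N)) :=
      (hΦ.comp (by fun_prop : Differentiable ℂ fun z : ℂ ↦
        x i - z - 2 * Real.pi * I / N)).div_const _
    obtain ⟨g, hg, hDg⟩ := exists_analyticAt_eventuallyEq_div_mul_sub (hA.analyticAt (x i))
      (hT.analyticAt (x i)) hP (by simp [Phi_zero])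
      (by rw [deriv_comp_const_sub, sub_self, deriv_Phi_zero hτ]; simp)
    refine ⟨_, hg.sub hS, ?_⟩
    filter_upwards [hDg] with z hz
    rw [Pi.sub_apply, ← hz, hDd]
    simp only
    rw [← Finset.mul_prod_erase _ _ (Finset.mem_univ i),
      ← Finset.add_sum_erase _ _ (Finset.mem_univ i), invEllf_def (x i - z)]
    simp only [hc]
    rw [mul_comm (Phi τ (x i - z)), div_mul_eq_div_div]
    ring
  have hD : ∀ p, ∃ g, AnalyticAt ℂ g p ∧ D =ᶠ[𝓝[≠] p] g := by
    intro p
    by_cases hp : ∀ i, x i - p ∉ lat τ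
    · exact ⟨D, hD_an p hp, .rfl⟩
    push Not at hp
    obtain ⟨i, m, n, hi⟩ := hp
    obtain ⟨g, hg, hDg⟩ := hD_pole i
    have hpi : p + 2 * Real.pi * I * (m * τ + n) = x i := by rw [← hi]; ring
    rw [← hpi] at hg hDg
    refine ⟨fun z ↦ (ζ⁻¹ ^ m)⁻¹ * g (z + 2 * Real.pi * I * (m * τ + n)),
      analyticAt_const.mul (hg.fun_comp (f := fun z ↦ z + 2 * Real.pi * I * (m * τ + n))
        (by fun_prop)), ?_⟩
    have ht : Tendsto (fun z ↦ z + 2 * Real.pi * I * (m * τ + n)) (𝓝[≠] p)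
        (𝓝[≠] (p + 2 * Real.pi * I * (m * τ + n))) := by
      refine tendsto_nhdsWithin_iff.2
        ⟨((continuous_add_const _).tendsto p).mono_left nhdsWithin_le_nhds, ?_⟩
      filter_upwards [self_mem_nhdsWithin] with w hw
      simpa using hw
    filter_upwards [ht.eventually hDg] with z hz
    rw [← hz, hmul, inv_mul_cancel_left₀ (zpow_ne_zero _ (inv_ne_zero hζ0))]
  have hnorm : ‖ζ⁻¹‖ = 1 := by
    rw [norm_inv, hprim.norm'_eq_one (by omega), inv_one]
  have h0 := eq_zero_of_lattice_multiplier hτ hnorm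
    (inv_ne_one.2 (hprim.ne_one (by omega))) hD hmul (hD_an z₀ hz₀).continuousAt
  exact sub_eq_zero.1 h0

lemma sum_prod_div_sub_eq_one {ι F : Type*} [Fintype ι] [Nonempty ι] [DecidableEq ι] [Field F]
    {x : ι → F} (hx : Function.Injective x) :
    ∑ i, ∏ j ∈ Finset.univ.erase i, x j / (x j - x i) = 1 := by
  have h := congrArg (Polynomial.eval 0)
    (Lagrange.sum_basis (s := Finset.univ) hx.injOn Finset.univ_nonempty)
  rw [Polynomial.eval_finsetSum, Polynomial.eval_one] at h
  rw [← h]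
  refine Finset.sum_congr rfl fun i _ ↦ ?_
  rw [Lagrange.basis, Polynomial.eval_prod]
  refine Finset.prod_congr rfl fun j _ ↦ ?_
  rw [Lagrange.basisDivisor, Polynomial.eval_mul, Polynomial.eval_C, Polynomial.eval_sub,
    Polynomial.eval_X, Polynomial.eval_C, zero_sub, ← neg_sub (x j), inv_neg, neg_mul_neg,
    div_eq_inv_mul]

/-- If `q ≡ 1 (mod N)`, `q ≥ 1`, and `x₁,…,x_q` are pairwise incongruent mod `L(τ)`
with no `xᵢ` in `L(τ)`, then
`∑ᵢ (1/f(xᵢ)) (∏_{j≠i} 1/f(x_j − xᵢ) − ∏_{j≠i} x_j/(f(x_j)(x_j − xᵢ))) = 0`. -/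
theorem sum_invEllf_sub_prod_eq_zero (τ : ℂ) (hτ : 0 < τ.im) (N : ℕ) (hN : 2 ≤ N)
    (q : ℕ) (hq : 1 ≤ q) (hqN : q % N = 1) (x : Fin q → ℂ)
    (hx0 : ∀ i, x i ∉ lat τ)
    (hxd : ∀ i j, i ≠ j → x i - x j ∉ lat τ) :
    ∑ i : Fin q,
        invEllf τ N (x i) *
          (∏ j ∈ Finset.univ.erase i, invEllf τ N (x j - x i) -
            ∏ j ∈ Finset.univ.erase i, x j * invEllf τ N (x j) / (x j - x i)) = 0 := by
  have := Fin.pos_iff_nonempty.1 hq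
  have hinj : Function.Injective x := by
    intro i j hij
    by_contra hne
    exact hxd i j hne (by rw [hij, sub_self]; exact zero_mem_lat)
  have hmain := prod_invEllf_sub_eq_sum hτ hN hqN hxd (z₀ := 0) (by simpa using hx0)
  simp only [sub_zero] at hmain
  simp_rw [mul_sub, Finset.sum_sub_distrib]
  rw [sub_eq_zero]
  calc _ = ∏ j, invEllf τ N (x j) := by
        rw [hmain]
        exact Finset.sum_congr rfl fun i _ ↦ mul_comm _ _
    _ = (∏ j, invEllf τ N (x j)) *
          ∑ i, ∏ j ∈ Finset.univ.erase i, x j / (x j - x i) := by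
        rw [sum_prod_div_sub_eq_one hinj, mul_one]
    _ = _ := by
        rw [Finset.mul_sum]
        refine Finset.sum_congr rfl fun i _ ↦ ?_
        rw [← Finset.mul_prod_erase _ _ (Finset.mem_univ i), mul_assoc, ← Finset.prod_mul_distrib]
        congr 1
        exact Finset.prod_congr rfl fun j _ ↦ by ring
end

section
/- Let L ⊂ ℂ be an additive subgroup that is a lattice (discrete and spanning ℂ as a real vector space), and let α ∈ ℂ satisfy N·α ∈ L and k·α ∉ L for all integers 1 ≤ k < N (so α is a primitive N-division point of ℂ/L). Then there exist τ ∈ ℍ and μ ∈ ℂ with μ ≠ 0 such that μ·L = L(τ) and μ·α − 2πi/N ∈ L(τ). (This is the surjectivity statement of the bijection between ℍ/Γ₁(N) and homothety classes of pairs consisting of a lattice together with a primitive N-division point, given by τ ↦ (2πi(ℤτ+ℤ), 2πi/N).) -/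
/-- The lattice `L(σ)`: the additive subgroup of `ℂ` generated by `2πiσ` and `2πi`. -/
noncomputable def latSub (σ : ℂ) : AddSubgroup ℂ :=
  AddSubgroup.closure {2 * Real.pi * Complex.I * σ, 2 * Real.pi * Complex.I}

/-- A pair of integers with no prime factor in common with `N` can be changed modulo `N`
into a coprime pair. -/
theorem Int.exists_isCoprime_add_mul (N : ℤ) (hN : N ≠ 0) (a b : ℤ)
    (h : ∀ p : ℕ, p.Prime → (p : ℤ) ∣ a → (p : ℤ) ∣ b → ¬ (p : ℤ) ∣ N) :
    ∃ s t : ℤ, IsCoprime (a + s * N) (b + t * N) := by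
  wlog ha : a ≠ 0 generalizing a
  · rw [not_not] at ha
    obtain ⟨s, t, hst⟩ := this (a + N) (fun p hp h₁ h₂ h₃ => h p hp
      (by simp [ha]) h₂ h₃) (by simpa [ha] using hN)
    exact ⟨s + 1, t, by convert hst using 1; ring⟩
  set S : Finset ℕ := {p ∈ a.natAbs.primeFactors | ¬ (p : ℤ) ∣ b} with hS
  refine ⟨0, ((∏ p ∈ S, p : ℕ) : ℤ), ?_⟩
  rw [zero_mul, add_zero, Int.isCoprime_iff_gcd_eq_one, Int.gcd]
  refine Nat.Coprime.symm (Nat.coprime_of_dvd fun p hp hpb hpa => ?_)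
  rw [← Int.natCast_dvd] at hpa hpb
  by_cases hb : (p : ℤ) ∣ b
  · have hpN := (Int.Prime.dvd_mul' hp ((dvd_add_right hb).1 hpb)).resolve_right (h p hp hpa hb)
    rw [Int.natCast_dvd_natCast, (Nat.prime_iff.1 hp).dvd_finsetProd_iff] at hpN
    obtain ⟨q, hq, hpq⟩ := hpN
    simp only [hS, Finset.mem_filter, Nat.mem_primeFactors] at hq
    rw [Nat.prime_dvd_prime_iff_eq hp hq.1.1] at hpq
    exact hq.2 (hpq ▸ hb)
  · refine hb ((dvd_add_left (Dvd.dvd.mul_right ?_ N)).1 hpb)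
    refine Int.natCast_dvd_natCast.2 (Finset.dvd_prod_of_mem (fun p => p) ?_)
    simp only [hS, Finset.mem_filter, Nat.mem_primeFactors]
    exact ⟨⟨hp, Int.natCast_dvd.1 hpa, by simpa using ha⟩, hb⟩

/-- A lattice in `ℂ` is generated by two complex numbers linearly independent over `ℝ`. -/
theorem Complex.exists_lattice_generators (L : AddSubgroup ℂ) (hdisc : DiscreteTopology L)
    (hspan : Submodule.span ℝ (L : Set ℂ) = ⊤) :
    ∃ w : Fin 2 → ℂ, LinearIndependent ℝ w ∧
      ∀ z, z ∈ L ↔ ∃ m n : ℤ, m * w 0 + n * w 1 = z := by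
  let M : Submodule ℤ ℂ := L.toIntSubmodule
  have : DiscreteTopology M := hdisc
  have : IsZLattice ℝ M := ⟨hspan⟩
  have hfin := ZLattice.module_finite ℝ M
  have hfree := ZLattice.module_free ℝ M
  let b : Module.Basis (Fin 2) ℤ M := Module.finBasisOfFinrankEq ℤ M
    (by rw [ZLattice.rank ℝ, Complex.finrank_real_complex])
  refine ⟨b.ofZLatticeBasis ℝ M, (b.ofZLatticeBasis ℝ M).linearIndependent, fun z => ?_⟩
  have hz : z ∈ L ↔ z ∈ Submodule.span ℤ (Set.range (b.ofZLatticeBasis ℝ M)) := by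
    rw [b.ofZLatticeBasis_span ℝ]; rfl
  rw [hz, Submodule.mem_span_range_iff_exists_fun]
  simp only [Fin.sum_univ_two, zsmul_eq_mul]
  exact ⟨fun ⟨c, hc⟩ => ⟨c 0, c 1, hc⟩, fun ⟨m, n, h⟩ => ⟨![m, n], h⟩⟩

theorem mem_latSub {σ z : ℂ} :
    z ∈ latSub σ ↔ ∃ m n : ℤ, m * (2 * Real.pi * Complex.I * σ) +
      n * (2 * Real.pi * Complex.I) = z := by
  simp [latSub, AddSubgroup.mem_closure_pair]

/-- If `u, v` generate `L` and `v / u` is not real, then `L` is homothetic to some `L(τ)` with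
`τ` in the upper half-plane, by a homothety sending `u` to `2πi`. -/
theorem exists_homothety_latSub (L : AddSubgroup ℂ) {u v : ℂ} (hu : u ≠ 0)
    (huv : (v / u).im ≠ 0) (hL : ∀ z, z ∈ L ↔ ∃ m n : ℤ, m * u + n * v = z) :
    ∃ τ : ℂ, 0 < τ.im ∧ (fun z : ℂ => 2 * Real.pi * Complex.I / u * z) '' (L : Set ℂ) =
      (latSub τ : Set ℂ) := by
  wlog hpos : 0 < (v / u).im generalizing v
  · refine this (v := -v) (by simpa [neg_div] using huv) (fun z => ?_) ?_
    · rw [hL]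
      exact ⟨fun ⟨m, n, h⟩ => ⟨m, -n, by simpa using h⟩,
        fun ⟨m, n, h⟩ => ⟨m, -n, by simpa using h⟩⟩
    · rw [neg_div, Complex.neg_im, neg_pos]
      exact lt_of_le_of_ne (not_lt.1 hpos) huv
  refine ⟨v / u, hpos, ?_⟩
  ext z
  simp only [Set.mem_image, SetLike.mem_coe, mem_latSub, hL]
  constructor
  · rintro ⟨_, ⟨m, n, rfl⟩, rfl⟩
    exact ⟨n, m, by field_simp; ring⟩
  · rintro ⟨m, n, rfl⟩
    exact ⟨_, ⟨n, m, rfl⟩, by field_simp; ring⟩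

/-- Surjectivity of `τ ↦ (2πi(ℤτ+ℤ), 2πi/N)`: every lattice `L ⊂ ℂ` together with a
primitive `N`-division point `α` is homothetic to some `(L(τ), 2πi/N)` with `τ` in the
upper half-plane. -/
theorem lattice_with_division_point_equiv (N : ℕ) (hN : 2 ≤ N) (L : AddSubgroup ℂ)
    (hdisc : DiscreteTopology L)
    (hspan : Submodule.span ℝ (L : Set ℂ) = ⊤)
    (α : ℂ) (hNα : (N : ℂ) * α ∈ L)
    (hprim : ∀ k : ℕ, 1 ≤ k → k < N → (k : ℂ) * α ∉ L) :
    ∃ τ : ℂ, 0 < τ.im ∧ ∃ μ : ℂ, μ ≠ 0 ∧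
      (fun z : ℂ => μ * z) '' (L : Set ℂ) = (latSub τ : Set ℂ) ∧
      μ * α - 2 * Real.pi * Complex.I / N ∈ latSub τ := by
  obtain ⟨w, hw, hL⟩ := Complex.exists_lattice_generators L hdisc hspan
  have hN0 : (N : ℂ) ≠ 0 := by exact_mod_cast (by omega : N ≠ 0)
  have hind : ∀ s t : ℝ, s * w 0 + t * w 1 = 0 → s = 0 ∧ t = 0 := fun s t h => by
    have := Fintype.linearIndependent_iff.1 hw ![s, t] (by simpa [Fin.sum_univ_two] using h)
    exact ⟨this 0, this 1⟩
  obtain ⟨a, b, hab⟩ := (hL _).1 hNα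
  obtain ⟨s, t, x, y, hxy⟩ := Int.exists_isCoprime_add_mul N (by omega) a b (by
    rintro p hp ⟨a', rfl⟩ ⟨b', rfl⟩ hpN
    obtain ⟨k, rfl⟩ := Int.natCast_dvd_natCast.1 hpN
    have hp0 : (p : ℂ) ≠ 0 := by exact_mod_cast hp.ne_zero
    have hk : 1 ≤ k := Nat.one_le_iff_ne_zero.2 (by rintro rfl; simp at hN0)
    refine hprim k hk (by nlinarith [hp.two_le]) ((hL _).2 ⟨a', b', mul_left_cancel₀ hp0 ?_⟩)
    push_cast at hab
    linear_combination hab)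
  set c := a + s * N with hc
  set d := b + t * N with hd
  have hxyC : (x : ℂ) * c + y * d = 1 := by exact_mod_cast hxy
  have hxyR : (x : ℝ) * c + y * d = 1 := by exact_mod_cast hxy
  set u : ℂ := c * w 0 + d * w 1 with hu_def
  set v : ℂ := -y * w 0 + x * w 1 with hv_def
  have hu : u ≠ 0 := fun h => by
    obtain ⟨h₁, h₂⟩ := hind c d (by exact_mod_cast h)
    simp [h₁, h₂] at hxyR
  have huv : (v / u).im ≠ 0 := fun h => by
    obtain ⟨r, hr⟩ : ∃ r : ℝ, v / u = r := ⟨(v / u).re, Complex.ext rfl (by simpa using h)⟩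
    rw [div_eq_iff hu] at hr
    obtain ⟨h₁, h₂⟩ := hind (r * c + y) (r * d - x) (by
      push_cast
      rw [hu_def, hv_def] at hr
      linear_combination -hr)
    have : (1 : ℝ) = 0 := by linear_combination -hxyR + d * h₁ - c * h₂
    exact one_ne_zero this
  have hL' : ∀ z, z ∈ L ↔ ∃ m n : ℤ, m * u + n * v = z := fun z => by
    rw [hL]
    constructor
    · rintro ⟨m, n, rfl⟩
      refine ⟨x * m + y * n, c * n - d * m, ?_⟩
      push_cast
      linear_combination (m * w 0 + n * w 1) * hxyC
    · rintro ⟨m, n, rfl⟩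
      refine ⟨m * c - n * y, m * d + n * x, ?_⟩
      push_cast
      ring
  obtain ⟨τ, hτ, himage⟩ := exists_homothety_latSub L hu huv hL'
  refine ⟨τ, hτ, _, div_ne_zero Complex.two_pi_I_ne_zero hu, himage, ?_⟩
  rw [← SetLike.mem_coe, ← himage]
  refine ⟨α - u / N, (hL _).2 ⟨-s, -t, mul_left_cancel₀ hN0 ?_⟩, by field_simp⟩
  rw [mul_sub, mul_div_cancel₀ _ hN0, ← hab, hu_def, hc, hd]
  push_cast
  ring
end
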